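/- With the setup parameter δ = 10⁻¹², let Γ be a segment barrier for the unit square U given by segments sᵢ with total length L ≤ 2 + δ. Let U₂ = [−10⁻³, 1 + 10⁻³] × [−10⁻³, 1 + 10⁻³]. Then Σᵢ H¹(sᵢ \ U₂) ≤ (5·10⁵ + 2) · δ = (5·10⁵ + 2) · 10⁻¹². -/

import Mathlib

open MeasureTheory Set

noncomputable section

/-- A point in the plane. -/
abbrev Pt : Type := EuclideanSpace ℝ (Fin 2)

/-- A line in ℝ² is a set {p + t • v : t ∈ ℝ} for some p, v with v ≠ 0. -/
def IsLine (l : Set Pt) : Prop :=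
  ∃ p v : Pt, v ≠ 0 ∧ l = {q : Pt | ∃ t : ℝ, q = p + t • v}

/-- Γ is a barrier (opaque set) for C if every line meeting C also meets Γ. -/
def IsBarrier (Γ C : Set Pt) : Prop :=
  ∀ l : Set Pt, IsLine l → (l ∩ C).Nonempty → (l ∩ Γ).Nonempty

/-- The closed unit square U = [0,1] × [0,1]. -/
def unitSquare : Set Pt := {p : Pt | p 0 ∈ Icc (0:ℝ) 1 ∧ p 1 ∈ Icc (0:ℝ) 1}


open Real

/-- the functional constant on lines of direction φ -/
def nf (φ x y : ℝ) : ℝ := -sin φ * x + cos φ * y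
def mm (φ : ℝ) : ℝ := min 0 (-sin φ) + min 0 (cos φ)
def MM (φ : ℝ) : ℝ := max 0 (-sin φ) + max 0 (cos φ)
def G (φ x y : ℝ) : Prop := mm φ ≤ nf φ x y ∧ nf φ x y ≤ MM φ
def tau : ℝ := arctan (1/500)

lemma tau_pos : 0 < tau := by unfold tau; exact Real.arctan_pos.2 (by norm_num)
lemma tan_tau : tan tau = 1/500 := Real.tan_arctan _
lemma tau_lt : tau < 1/4 := by
  have h1 := tau_pos
  have h2 : tau < π/2 := Real.arctan_lt_pi_div_two _
  have := Real.le_tan h1.le h2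
  rw [tan_tau] at this; linarith

lemma cos_tau_sq : cos tau ^ 2 = 250000/250001 := by
  unfold tau; rw [Real.cos_sq_arctan]; norm_num
lemma cos_tau_pos : 0 < cos tau := Real.cos_arctan_pos _
lemma cos_tau_le : cos tau ≤ 1 - 1/500002 := by
  have := cos_tau_sq
  have := cos_tau_pos
  nlinarith
lemma sin_tau : sin tau = cos tau / 500 := by
  have := Real.tan_mul_cos cos_tau_pos.ne'
  rw [tan_tau] at this; linarith

lemma halfA (x : ℝ) (hx : 1/2 ≤ x) : ∃ c, -(2*tau) ≤ c - tau ∧ c + tau ≤ 2*tau ∧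
    ∀ φ ∈ Ioo (c - tau) (c + tau), 0 < cos φ/1000 + x * sin φ ∧ 0 < cos φ/1000 - (1-x)*sin φ := by
  have ht := tau_pos
  have ht2 := tau_lt
  have hpi := Real.pi_gt_three
  set t1 := arctan (1/1000/x) with ht1
  have hx0 : 0 < x := by linarith
  have h0 : 0 < t1 := Real.arctan_pos.2 (by positivity)
  have h1 : t1 ≤ tau := by
    apply Real.arctan_le_arctan_iff.2
    rw [div_le_iff₀ hx0]; linarith
  have hc : 0 < cos t1 := Real.cos_arctan_pos _
  have hs : x * sin t1 = cos t1/1000 := by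
    have := Real.tan_mul_cos hc.ne'
    rw [ht1, Real.tan_arctan, ← ht1] at this
    rw [← this]; field_simp
  refine ⟨tau - t1, by linarith, by linarith, ?_⟩
  rintro φ ⟨hφ1, hφ2⟩
  have hcφ : 0 < cos φ := Real.cos_pos_of_mem_Ioo ⟨by linarith, by linarith⟩
  have k1 : 0 < cos φ/1000 + x * sin φ := by
    have h : 0 < sin (φ + t1) := Real.sin_pos_of_pos_of_lt_pi (by linarith) (by linarith)
    rw [Real.sin_add] at h
    have : cos t1 * (cos φ/1000 + x * sin φ) = x * (sin φ * cos t1 + cos φ * sin t1) := by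
      linear_combination (-cos φ) * hs
    have h3 : 0 < cos t1 * (cos φ/1000 + x * sin φ) := by rw [this]; positivity
    exact (pos_iff_pos_of_mul_pos h3).1 hc
  refine ⟨k1, ?_⟩
  rcases le_total φ 0 with hn | hp
  · have : sin φ ≤ 0 := Real.sin_nonpos_of_nonpos_of_neg_pi_le hn (by linarith)
    rcases le_total x 1 with h | h
    · nlinarith
    · nlinarith
  · have hsp : 0 ≤ sin φ := Real.sin_nonneg_of_nonneg_of_le_pi hp (by linarith)
    rcases le_total x 1 with h | h
    · have e1 : cos (2*tau - t1) < cos φ :=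
        Real.cos_lt_cos_of_nonneg_of_le_pi_div_two hp (by linarith) (by linarith)
      have e2 : sin φ ≤ sin (2*tau - t1) :=
        Real.sin_le_sin_of_le_of_le_pi_div_two (by linarith) (by linarith) (by linarith)
      have e3 : 0 ≤ cos (2*tau - t1)/1000 - (1-x)*sin (2*tau - t1) := by
        have hC : cos (2*tau) = 249999/250001 := by
          rw [Real.cos_two_mul, cos_tau_sq]; norm_num
        have hS : sin (2*tau) = 1000/250001 := by
          rw [Real.sin_two_mul, sin_tau]
          have := cos_tau_sq
          nlinarith
        rw [Real.cos_sub, Real.sin_sub, hC, hS]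
        have e : x * ((249999/250001 * cos t1 + 1000/250001 * sin t1)/1000 - (1-x)*(1000/250001 * cos t1 - 249999/250001 * sin t1)) = cos t1 * (1000/250001 * (x-1/2)^2) := by
          linear_combination (1/250001 + (1-x)*249999/250001) * hs
        have : 0 ≤ x * ((249999/250001 * cos t1 + 1000/250001 * sin t1)/1000 - (1-x)*(1000/250001 * cos t1 - 249999/250001 * sin t1)) := by
          rw [e]; positivity
        exact nonneg_of_mul_nonneg_right this hx0
      nlinarith
    · nlinarith

lemma fullA (x : ℝ) : ∃ c, -(2*tau) ≤ c - tau ∧ c + tau ≤ 2*tau ∧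
    ∀ φ ∈ Ioo (c - tau) (c + tau), 0 < cos φ/1000 + x * sin φ ∧ 0 < cos φ/1000 - (1-x)*sin φ := by
  rcases le_total (1/2) x with h | h
  · exact halfA x h
  · obtain ⟨c, h1, h2, h3⟩ := halfA (1-x) (by linarith)
    refine ⟨-c, by linarith, by linarith, ?_⟩
    rintro φ ⟨hφ1, hφ2⟩
    obtain ⟨k1, k2⟩ := h3 (-φ) ⟨by linarith, by linarith⟩
    rw [Real.cos_neg, Real.sin_neg] at k1 k2
    constructor <;> linarith

lemma bottom (x y : ℝ) (hy : y < -(1/1000)) : ∃ c, -(2*tau) ≤ c - tau ∧ c + tau ≤ 2*tau ∧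
    ∀ φ ∈ Ioo (c - tau) (c + tau), ¬ G φ x y := by
  obtain ⟨c, h1, h2, h3⟩ := fullA x
  refine ⟨c, h1, h2, ?_⟩
  have ht2 := tau_lt
  have hpi := Real.pi_gt_three
  rintro φ hφ ⟨hg, -⟩
  obtain ⟨k1, k2⟩ := h3 φ hφ
  have hcφ : 0 < cos φ := Real.cos_pos_of_mem_Ioo ⟨by linarith [hφ.1], by linarith [hφ.2]⟩
  unfold mm nf at hg
  rw [min_eq_left hcφ.le] at hg
  have : cos φ * y < cos φ * (-(1/1000)) := by gcongr
  rcases min_choice 0 (-sin φ) with h | h <;> rw [h] at hg <;> linarith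

lemma G_refl (φ x y : ℝ) (h : G φ x y) : G φ (1-x) (1-y) := by
  have e : mm φ + MM φ = - sin φ + cos φ := by
    unfold mm MM
    have := min_add_max 0 (-sin φ)
    have := min_add_max 0 (cos φ)
    linarith
  obtain ⟨h1, h2⟩ := h
  have : nf φ (1-x) (1-y) = mm φ + MM φ - nf φ x y := by rw [e]; unfold nf; ring
  constructor <;> rw [this] <;> linarith

lemma G_swap (φ x y : ℝ) (h : G φ x y) : G (π/2-φ) y x := by
  have e1 : mm (π/2-φ) = - MM φ := by
    unfold mm MM
    rw [Real.sin_pi_div_two_sub, Real.cos_pi_div_two_sub]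
    have := max_neg_neg 0 (sin φ)
    have := max_neg_neg 0 (-cos φ)
    simp only [neg_zero, neg_neg] at *
    linarith
  have e2 : MM (π/2-φ) = - mm φ := by
    unfold mm MM
    rw [Real.sin_pi_div_two_sub, Real.cos_pi_div_two_sub]
    have := max_neg_neg 0 (-sin φ)
    have := max_neg_neg 0 (cos φ)
    simp only [neg_zero, neg_neg] at *
    linarith
  obtain ⟨h1, h2⟩ := h
  have : nf (π/2-φ) y x = - nf φ x y := by
    unfold nf
    rw [Real.sin_pi_div_two_sub, Real.cos_pi_div_two_sub]; ring
  constructor <;> rw [this] <;> linarith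

lemma outside (x y : ℝ) (h : ¬ ((-(1/1000) ≤ x ∧ x ≤ 1 + 1/1000) ∧ (-(1/1000) ≤ y ∧ y ≤ 1 + 1/1000))) :
    ∃ c, -(π/4) ≤ c - tau ∧ c + tau ≤ 3*π/4 ∧
    ∀ φ ∈ Ioo (c - tau) (c + tau), ¬ G φ x y := by
  have ht2 := tau_lt
  have hpi := Real.pi_gt_three
  have key : ∀ x y : ℝ, (y < -(1/1000) ∨ 1 + 1/1000 < y) → ∃ c, -(2*tau) ≤ c - tau ∧ c + tau ≤ 2*tau ∧
    ∀ φ ∈ Ioo (c - tau) (c + tau), ¬ G φ x y := by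
    rintro x y (h | h)
    · exact bottom x y h
    · obtain ⟨c, h1, h2, h3⟩ := bottom (1-x) (1-y) (by linarith)
      exact ⟨c, h1, h2, fun φ hφ hg => h3 φ hφ (G_refl _ _ _ hg)⟩
  by_cases hy : (y < -(1/1000) ∨ 1 + 1/1000 < y)
  · obtain ⟨c, h1, h2, h3⟩ := key x y hy
    exact ⟨c, by linarith, by linarith, h3⟩
  · have hx : (x < -(1/1000) ∨ 1 + 1/1000 < x) := by
      by_contra hx
      push Not at hx hy
      exact h ⟨hx, hy⟩
    obtain ⟨c, h1, h2, h3⟩ := key y x hx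
    refine ⟨π/2 - c, by linarith, by linarith, fun φ hφ hg => h3 (π/2-φ) ⟨by linarith [hφ.2], by linarith [hφ.1]⟩ (G_swap _ _ _ hg)⟩

lemma int_full (β : ℝ) : ∫ φ in (-(π/4))..(3*π/4), |sin (φ - β)| = 2 := by
  have hp : Function.Periodic (fun s => |sin s|) π := by
    intro s; simp [Real.sin_add_pi]
  rw [intervalIntegral.integral_comp_sub_right (fun s => |sin s|) β]
  have e : 3*π/4 - β = (-(π/4) - β) + π := by ring
  rw [e, hp.intervalIntegral_add_eq _ 0, zero_add]
  rw [intervalIntegral.integral_congr (g := sin)]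
  · rw [integral_sin]; norm_num
  · intro s hs
    rw [uIcc_of_le Real.pi_pos.le] at hs
    exact abs_of_nonneg (Real.sin_nonneg_of_mem_Icc hs)

lemma ii_abs (a b : ℝ) : IntervalIntegrable (fun s => |sin s|) volume a b :=
  (Real.continuous_sin.abs).intervalIntegrable a b

lemma int_part0 (c : ℝ) (h1 : -tau ≤ c) (h2 : c ≤ π - tau) :
    2*(1 - cos tau) ≤ ∫ s in (c - tau)..(c + tau), |sin s| := by
  have ht := tau_pos
  have ht2 := tau_lt
  have hpi := Real.pi_gt_three
  have hc0 := cos_tau_pos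
  have hc1 := Real.cos_le_one tau
  have hcc := Real.cos_le_one c
  rcases le_total c tau with h | h
  · rw [← intervalIntegral.integral_add_adjacent_intervals (ii_abs (c-tau) 0) (ii_abs 0 (c+tau))]
    have e1 : ∫ s in (c-tau)..0, |sin s| = ∫ s in (c-tau)..0, -sin s := by
      apply intervalIntegral.integral_congr
      intro s hs
      rw [uIcc_of_le (by linarith)] at hs
      exact abs_of_nonpos (Real.sin_nonpos_of_nonpos_of_neg_pi_le hs.2 (by linarith [hs.1]))
    have e2 : ∫ s in (0:ℝ)..(c+tau), |sin s| = ∫ s in (0:ℝ)..(c+tau), sin s := by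
      apply intervalIntegral.integral_congr
      intro s hs
      rw [uIcc_of_le (by linarith)] at hs
      exact abs_of_nonneg (Real.sin_nonneg_of_nonneg_of_le_pi hs.1 (by linarith [hs.2]))
    rw [e1, e2, intervalIntegral.integral_neg, integral_sin, integral_sin, Real.cos_sub, Real.cos_add, Real.cos_zero]
    nlinarith
  · have e2 : ∫ s in (c-tau)..(c+tau), |sin s| = ∫ s in (c-tau)..(c+tau), sin s := by
      apply intervalIntegral.integral_congr
      intro s hs
      rw [uIcc_of_le (by linarith)] at hs
      exact abs_of_nonneg (Real.sin_nonneg_of_nonneg_of_le_pi (by linarith [hs.1]) (by linarith [hs.2]))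
    rw [e2, integral_sin, Real.cos_sub, Real.cos_add]
    have hst : 0 < sin tau := Real.sin_pos_of_pos_of_lt_pi ht (by linarith)
    have : sin tau ≤ sin c := by
      rcases le_total c (π/2) with k | k
      · exact Real.sin_le_sin_of_le_of_le_pi_div_two (by linarith) k h
      · rw [← Real.sin_pi_sub c]
        exact Real.sin_le_sin_of_le_of_le_pi_div_two (by linarith) (by linarith) (by linarith)
    nlinarith [Real.sin_sq_add_cos_sq tau]

lemma int_part (c β : ℝ) :
    2*(1 - cos tau) ≤ ∫ φ in (c - tau)..(c + tau), |sin (φ - β)| := by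
  rw [intervalIntegral.integral_comp_sub_right (fun s => |sin s|) β]
  obtain ⟨k, hk, -⟩ := existsUnique_add_zsmul_mem_Ico Real.pi_pos (c - β) (-tau)
  have := int_part0 (c - β + k • π) hk.1 (by linarith [hk.2])
  refine this.trans (le_of_eq ?_)
  have hp : Function.Periodic (fun s => |sin s|) π := by
    intro s; simp [Real.sin_add_pi]
  have e : (fun s => |sin s|) = fun s => |sin (s + k • π)| := by
    funext s; exact ((hp.zsmul k) s).symm
  conv_rhs => rw [e]
  rw [intervalIntegral.integral_comp_add_right (fun s => |sin s|)]
  congr 1 <;> ring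

lemma polar (x y : ℝ) : ∃ β, ∀ φ, |nf φ x y| = √(x^2+y^2) * |sin (φ - β)| := by
  refine ⟨Complex.arg ⟨x, y⟩, fun φ => ?_⟩
  have h1 := Complex.norm_mul_cos_arg ⟨x, y⟩
  have h2 := Complex.norm_mul_sin_arg ⟨x, y⟩
  have h3 : ‖(⟨x, y⟩ : ℂ)‖ = √(x^2+y^2) := by
    rw [Complex.norm_def, Complex.normSq_mk]; ring_nf
  rw [h3] at h1 h2
  simp only at h1 h2
  set r := √(x^2+y^2)
  set β := Complex.arg ⟨x, y⟩
  have hr : |r| = r := abs_of_nonneg (Real.sqrt_nonneg (x^2+y^2))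
  rw [← hr, ← abs_mul, ← abs_neg]
  congr 1
  unfold nf
  rw [← h1, ← h2, Real.sin_sub]; ring

lemma nf_cont (x y : ℝ) : Continuous fun φ => nf φ x y := by unfold nf; fun_prop

lemma lint_eq (x y a b : ℝ) (hab : a ≤ b) : ∫⁻ φ in Ioc a b, ENNReal.ofReal |nf φ x y| =
    ENNReal.ofReal (∫ φ in a..b, |nf φ x y|) := by
  rw [intervalIntegral.integral_of_le hab, ofReal_integral_eq_lintegral_ofReal]
  · exact ((nf_cont x y).abs.intervalIntegrable a b).1
  · exact Filter.Eventually.of_forall fun _ => abs_nonneg _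

lemma lint_full (x y : ℝ) : ∫⁻ φ in Ioc (-(π/4)) (3*π/4), ENNReal.ofReal |nf φ x y| =
    ENNReal.ofReal (2 * √(x^2+y^2)) := by
  obtain ⟨β, hβ⟩ := polar x y
  rw [lint_eq _ _ _ _ (by linarith [Real.pi_pos])]
  simp only [hβ]
  rw [intervalIntegral.integral_const_mul, int_full, mul_comm]

lemma lint_part (x y c : ℝ) : ENNReal.ofReal (2 * (1 - cos tau) * √(x^2+y^2)) ≤
    ∫⁻ φ in Ioo (c - tau) (c + tau), ENNReal.ofReal |nf φ x y| := by
  obtain ⟨β, hβ⟩ := polar x y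
  rw [restrict_Ioo_eq_restrict_Ioc, lint_eq _ _ _ _ (by linarith [tau_pos])]
  simp only [hβ]
  rw [intervalIntegral.integral_const_mul, mul_comm]
  apply ENNReal.ofReal_le_ofReal
  gcongr
  exact int_part c β

open Classical in
lemma pointwise (x y v w : ℝ) :
    (∫⁻ φ in Ioc (-(π/4)) (3*π/4), if G φ x y then ENNReal.ofReal |nf φ v w| else 0) +
    (if ((-(1/1000) ≤ x ∧ x ≤ 1 + 1/1000) ∧ (-(1/1000) ≤ y ∧ y ≤ 1 + 1/1000)) then 0 else
      ENNReal.ofReal (2 * (1 - cos tau) * √(v^2+w^2))) ≤ ENNReal.ofReal (2 * √(v^2+w^2)) := by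
  rw [← lint_full]
  split_ifs with h
  · rw [add_zero]
    apply lintegral_mono
    intro φ
    dsimp only
    split_ifs <;> simp
  · obtain ⟨c, h1, h2, h3⟩ := outside x y h
    have hsub : Ioo (c - tau) (c + tau) ⊆ Ioc (-(π/4)) (3*π/4) := fun φ hφ => ⟨by linarith [hφ.1], by linarith [hφ.2]⟩
    have hm : MeasurableSet (Ioo (c - tau) (c + tau)) := measurableSet_Ioo
    rw [← lintegral_inter_add_sdiff _ (Ioc (-(π/4)) (3*π/4)) hm, ← lintegral_inter_add_sdiff (fun φ => ENNReal.ofReal |nf φ v w|) (Ioc (-(π/4)) (3*π/4)) hm, inter_eq_right.2 hsub]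
    have z : ∫⁻ φ in Ioo (c - tau) (c + tau), (if G φ x y then ENNReal.ofReal |nf φ v w| else 0) = 0 := by
      rw [setLIntegral_congr_fun (g := fun _ => 0) hm]
      · simp
      · intro φ hφ
        simp [h3 φ hφ]
    rw [z, zero_add, add_comm]
    refine add_le_add (lint_part v w c) (lintegral_mono ?_)
    intro φ
    dsimp only
    split_ifs <;> simp

lemma hmeas {X : Type*} [MetricSpace X] [MeasurableSpace X] [BorelSpace X] (f : ℝ → X) (K : ℝ) (hK : 0 ≤ K)
    (hf : ∀ s t, dist (f s) (f t) ≤ K * dist s t) (S : Set ℝ) :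
    μH[1] (f '' S) ≤ ENNReal.ofReal K * volume S := by
  have hl : LipschitzWith ⟨K, hK⟩ f := LipschitzWith.of_dist_le_mul hf
  have := (hl.lipschitzOnWith (s := S)).hausdorffMeasure_image_le (d := 1) zero_le_one
  rw [hausdorffMeasure_real] at this
  refine this.trans (le_of_eq ?_)
  rw [ENNReal.rpow_one, ENNReal.ofReal_eq_coe_nnreal hK]; rfl

lemma width (φ : ℝ) : MM φ - mm φ = |sin φ| + |cos φ| := by
  unfold MM mm
  have h1 := max_sub_min_eq_abs 0 (-sin φ)
  have h2 := max_sub_min_eq_abs 0 (cos φ)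
  simp only [sub_zero, abs_neg] at h1 h2
  linarith

lemma hit (φ z : ℝ) (hz : z ∈ Icc (mm φ) (MM φ)) :
    ∃ X ∈ Icc (0:ℝ) 1, ∃ Y ∈ Icc (0:ℝ) 1, nf φ X Y = z := by
  have hw := width φ
  have hpos : 0 < |sin φ| + |cos φ| := by
    have := Real.sin_sq_add_cos_sq φ
    by_contra h
    have h1 := abs_nonneg (sin φ)
    have h2 := abs_nonneg (cos φ)
    have h3 : sin φ = 0 := abs_eq_zero.1 (by linarith)
    have h4 : cos φ = 0 := abs_eq_zero.1 (by linarith)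
    rw [h3, h4] at this; norm_num at this
  obtain ⟨θ, hθ⟩ : ∃ θ, θ = (z - mm φ)/(|sin φ| + |cos φ|) := ⟨_, rfl⟩
  have h0 : 0 ≤ θ := by rw [hθ]; exact div_nonneg (by linarith [hz.1]) hpos.le
  have h1 : θ ≤ 1 := by rw [hθ, div_le_one hpos]; linarith [hz.2]
  have e : z = mm φ + θ * (|sin φ| + |cos φ|) := by rw [hθ]; field_simp; ring
  have hX : ∃ X ∈ Icc (0:ℝ) 1, -sin φ * X = min 0 (-sin φ) + θ * |sin φ| := by
    rcases le_total 0 (sin φ) with h | h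
    · refine ⟨1-θ, ⟨by linarith, by linarith⟩, ?_⟩
      rw [min_eq_right (by linarith), abs_of_nonneg h]; ring
    · refine ⟨θ, ⟨by linarith, by linarith⟩, ?_⟩
      rw [min_eq_left (by linarith), abs_of_nonpos h]; ring
  have hY : ∃ Y ∈ Icc (0:ℝ) 1, cos φ * Y = min 0 (cos φ) + θ * |cos φ| := by
    rcases le_total 0 (cos φ) with h | h
    · refine ⟨θ, ⟨by linarith, by linarith⟩, ?_⟩
      rw [min_eq_left (by linarith), abs_of_nonneg h]; ring
    · refine ⟨1-θ, ⟨by linarith, by linarith⟩, ?_⟩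
      rw [min_eq_right (by linarith), abs_of_nonpos h]; ring
  obtain ⟨X, hX, eX⟩ := hX
  obtain ⟨Y, hY, eY⟩ := hY
  refine ⟨X, hX, Y, hY, ?_⟩
  unfold nf
  rw [eX, eY, e, mm]; ring

/-- points on the segment -/
def sx (a b : Pt) (t : ℝ) : ℝ := a 0 + t * (b 0 - a 0)
def sy (a b : Pt) (t : ℝ) : ℝ := a 1 + t * (b 1 - a 1)

lemma seg_mem (a b q : Pt) (hq : q ∈ segment ℝ a b) : ∃ t ∈ Icc (0:ℝ) 1, q = a + t • (b - a) := by
  rw [segment_eq_image'] at hq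
  obtain ⟨t, ht, rfl⟩ := hq
  exact ⟨t, ht, rfl⟩

lemma cover (a b : ℕ → Pt)
    (hbar : IsBarrier (⋃ i, segment ℝ (a i) (b i)) unitSquare) (φ : ℝ) :
    ENNReal.ofReal (|sin φ| + |cos φ|) ≤ ∑' i, ENNReal.ofReal |nf φ (b i 0 - a i 0) (b i 1 - a i 1)| *
      volume ({t | G φ (sx (a i) (b i) t) (sy (a i) (b i) t)} ∩ Icc 0 1) := by
  rw [← width, ← Real.volume_Icc]
  have hsub : Icc (mm φ) (MM φ) ⊆ ⋃ i, (fun t => nf φ (sx (a i) (b i) t) (sy (a i) (b i) t)) ''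
      ({t | G φ (sx (a i) (b i) t) (sy (a i) (b i) t)} ∩ Icc 0 1) := by
    intro z hz
    obtain ⟨X, hX, Y, hY, hXY⟩ := hit φ z hz
    have hv : (!₂[cos φ, sin φ] : Pt) ≠ 0 := by
      intro h
      have h0 := congrArg (fun q : Pt => q 0) h
      have h1 := congrArg (fun q : Pt => q 1) h
      simp at h0 h1
      have := Real.sin_sq_add_cos_sq φ
      rw [h0, h1] at this; norm_num at this
    obtain ⟨q, hq, hqΓ⟩ := hbar {q : Pt | ∃ t : ℝ, q = !₂[X, Y] + t • !₂[cos φ, sin φ]} ⟨_, _, hv, rfl⟩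
      ⟨!₂[X, Y], ⟨0, by simp⟩, by simpa using hX, by simpa using hY⟩
    obtain ⟨s, hs⟩ := hq
    obtain ⟨i, hi⟩ := mem_iUnion.1 hqΓ
    obtain ⟨t, ht, hqt⟩ := seg_mem _ _ _ hi
    have e : nf φ (sx (a i) (b i) t) (sy (a i) (b i) t) = z := by
      have e0 : sx (a i) (b i) t = X + s * cos φ := by
        have := congrArg (fun q : Pt => q 0) (hqt.symm.trans hs)
        simpa [sx] using this
      have e1 : sy (a i) (b i) t = Y + s * sin φ := by
        have := congrArg (fun q : Pt => q 1) (hqt.symm.trans hs)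
        simpa [sy] using this
      rw [e0, e1, ← hXY]; unfold nf; ring
    refine mem_iUnion.2 ⟨i, t, ⟨?_, ht⟩, e⟩
    change G _ _ _
    unfold G
    rw [e]; exact hz
  refine (measure_mono hsub).trans ((measure_iUnion_le _).trans ?_)
  gcongr with i
  rw [← hausdorffMeasure_real]
  nth_rewrite 2 [hausdorffMeasure_real]
  apply hmeas _ _ (abs_nonneg _)
  intro s t
  rw [Real.dist_eq, Real.dist_eq, ← abs_mul]
  apply le_of_eq
  congr 1
  unfold nf sx sy; ring

lemma meas_G (a b : Pt) : MeasurableSet {z : ℝ × ℝ | G z.2 (sx a b z.1) (sy a b z.1)} := by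
  have h1 : Continuous fun z : ℝ × ℝ => nf z.2 (sx a b z.1) (sy a b z.1) := by
    unfold nf sx sy; fun_prop
  have h2 : Continuous fun z : ℝ × ℝ => mm z.2 := by unfold mm; fun_prop
  have h3 : Continuous fun z : ℝ × ℝ => MM z.2 := by unfold MM; fun_prop
  exact ((isClosed_le h2 h1).inter (isClosed_le h1 h3)).measurableSet

lemma width_int : ∫⁻ φ in Ioc (-(π/4)) (3*π/4), ENNReal.ofReal (|sin φ| + |cos φ|) = ENNReal.ofReal 4 := by
  have h1 := lint_full 1 0
  have h2 := lint_full 0 1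
  simp [nf] at h1 h2
  simp_rw [ENNReal.ofReal_add (abs_nonneg _) (abs_nonneg _)]
  rw [lintegral_add_left (by fun_prop), h1, h2]
  norm_num

lemma norm_eq (a b : Pt) : √((b 0 - a 0)^2 + (b 1 - a 1)^2) = ‖b - a‖ := by
  rw [EuclideanSpace.norm_eq]; simp [Fin.sum_univ_two]

def U2 (a b : Pt) : Set ℝ := {t | (-(1/1000) ≤ sx a b t ∧ sx a b t ≤ 1 + 1/1000) ∧ (-(1/1000) ≤ sy a b t ∧ sy a b t ≤ 1 + 1/1000)}

lemma meas_U2 (a b : Pt) : MeasurableSet (U2 a b) := by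
  unfold U2 sx sy
  measurability

open Classical in
lemma per_seg (a b : Pt) :
    (∫⁻ φ in Ioc (-(π/4)) (3*π/4), ENNReal.ofReal |nf φ (b 0 - a 0) (b 1 - a 1)| *
      volume ({t | G φ (sx a b t) (sy a b t)} ∩ Icc 0 1)) +
    ENNReal.ofReal (2 * (1 - cos tau)) * (ENNReal.ofReal ‖b - a‖ * volume ((U2 a b)ᶜ ∩ Icc 0 1)) ≤ 
    ENNReal.ofReal (2 * ‖b - a‖) := by
  have hP := fun t => pointwise (sx a b t) (sy a b t) (b 0 - a 0) (b 1 - a 1)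
  simp_rw [norm_eq] at hP
  have hI := lintegral_mono (μ := volume.restrict (Icc (0:ℝ) 1)) hP
  rw [lintegral_const, Measure.restrict_apply MeasurableSet.univ, univ_inter, Real.volume_Icc, sub_zero, ENNReal.ofReal_one, mul_one] at hI
  refine le_trans (le_of_eq ?_) hI
  have hmeas2 : Measurable fun z : ℝ × ℝ => if G z.2 (sx a b z.1) (sy a b z.1) then ENNReal.ofReal |nf z.2 (b 0 - a 0) (b 1 - a 1)| else 0 := by
    apply Measurable.ite (meas_G a b)
    · unfold nf; fun_prop
    · fun_prop
  rw [lintegral_add_left]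
  · congr 1
    · rw [lintegral_lintegral_swap hmeas2.aemeasurable]
      apply lintegral_congr
      intro φ
      have hGm : MeasurableSet {t | G φ (sx a b t) (sy a b t)} := by
        have : Measurable fun t : ℝ => (t, φ) := by fun_prop
        exact this (meas_G a b)
      have : (fun t => if G φ (sx a b t) (sy a b t) then ENNReal.ofReal |nf φ (b 0 - a 0) (b 1 - a 1)| else 0)
        = indicator {t | G φ (sx a b t) (sy a b t)} (fun _ => ENNReal.ofReal |nf φ (b 0 - a 0) (b 1 - a 1)|) := by
        funext t; simp [indicator]
      rw [this, lintegral_indicator_const hGm, Measure.restrict_apply hGm]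
    · have : (fun t => if ((-(1/1000) ≤ sx a b t ∧ sx a b t ≤ 1 + 1/1000) ∧ (-(1/1000) ≤ sy a b t ∧ sy a b t ≤ 1 + 1/1000)) then 0 else
          ENNReal.ofReal (2 * (1 - cos tau) * ‖b - a‖))
        = indicator (U2 a b)ᶜ (fun _ => ENNReal.ofReal (2 * (1 - cos tau) * ‖b - a‖)) := by
        funext t
        by_cases h : t ∈ U2 a b
        · rw [indicator_of_notMem (by simpa using h)]; exact if_pos h
        · rw [indicator_of_mem (by simpa using h)]; exact if_neg h
      rw [this, lintegral_indicator_const (meas_U2 a b).compl, Measure.restrict_apply (meas_U2 a b).compl, ENNReal.ofReal_mul (p := 2 * (1 - cos tau)), mul_assoc]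
      linarith [Real.cos_le_one tau]
  · exact hmeas2.lintegral_prod_right'

lemma seg_H (a b : Pt) : μH[1] (segment ℝ a b \
        {p : Pt | p 0 ∈ Icc (-(10:ℝ) ^ (-3 : ℤ)) (1 + 10 ^ (-3 : ℤ)) ∧
                  p 1 ∈ Icc (-(10:ℝ) ^ (-3 : ℤ)) (1 + 10 ^ (-3 : ℤ))})
      ≤ ENNReal.ofReal ‖b - a‖ * volume ((U2 a b)ᶜ ∩ Icc 0 1) := by
  refine le_trans (measure_mono ?_) (hmeas (fun t : ℝ => a + t • (b - a)) ‖b - a‖ (norm_nonneg _) ?_ _)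
  · rintro q ⟨hq, hn⟩
    obtain ⟨t, ht, rfl⟩ := seg_mem _ _ _ hq
    refine ⟨t, ⟨fun h => hn ?_, ht⟩, rfl⟩
    have e : (10:ℝ) ^ (-3 : ℤ) = 1/1000 := by norm_num
    simp only [e, U2, sx, sy, mem_ofPred_eq, mem_Icc] at h ⊢
    simpa using h
  · intro s t
    rw [dist_add_left, dist_eq_norm, ← sub_smul, norm_smul, Real.dist_eq, Real.norm_eq_abs, mul_comm]

/-- Lemma 9: for a segment barrier of the unit square of total length at
most 2 + δ (δ = 10⁻¹²), the total length of the parts of the segments outside the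
enlarged square U₂ = [−10⁻³, 1 + 10⁻³]² is at most (5·10⁵ + 2)·δ. -/
theorem barrier_outside_U2_small
    (a b : ℕ → Pt) (hab : ∀ i, a i ≠ b i)
    (hbar : IsBarrier (⋃ i, segment ℝ (a i) (b i)) unitSquare)
    (hsum : Summable fun i => ‖b i - a i‖)
    (hL : ∑' i, ‖b i - a i‖ ≤ 2 + 10 ^ (-12 : ℤ)) :
    ∑' i, μH[1] (segment ℝ (a i) (b i) \
        {p : Pt | p 0 ∈ Icc (-(10:ℝ) ^ (-3 : ℤ)) (1 + 10 ^ (-3 : ℤ)) ∧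
                  p 1 ∈ Icc (-(10:ℝ) ^ (-3 : ℤ)) (1 + 10 ^ (-3 : ℤ))})
      ≤ ENNReal.ofReal ((5 * 10 ^ (5 : ℕ) + 2) * 10 ^ (-12 : ℤ)) := by
  refine (ENNReal.tsum_le_tsum fun i => seg_H (a i) (b i)).trans ?_
  set W := ∑' i, ENNReal.ofReal ‖b i - a i‖ * volume ((U2 (a i) (b i))ᶜ ∩ Icc 0 1) with hW
  have hS := ENNReal.tsum_le_tsum fun i => per_seg (a i) (b i)
  rw [ENNReal.tsum_add, ENNReal.tsum_mul_left, ← hW, ← ENNReal.ofReal_tsum_of_nonneg (fun i => by positivity) (hsum.mul_left 2), tsum_mul_left] at hS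
  have h4 : ENNReal.ofReal 4 ≤ ∑' i, ∫⁻ φ in Ioc (-(π/4)) (3*π/4), ENNReal.ofReal |nf φ (b i 0 - a i 0) (b i 1 - a i 1)| *
      volume ({t | G φ (sx (a i) (b i) t) (sy (a i) (b i) t)} ∩ Icc 0 1) := by
    rw [← width_int, ← lintegral_tsum]
    · exact lintegral_mono fun φ => cover a b hbar φ
    · intro i
      apply Measurable.aemeasurable
      apply Measurable.mul
      · unfold nf; fun_prop
      · have hm : MeasurableSet {z : ℝ × ℝ | G z.2 (sx (a i) (b i) z.1) (sy (a i) (b i) z.1) ∧ z.1 ∈ Icc (0:ℝ) 1} :=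
          (meas_G (a i) (b i)).inter (measurable_fst measurableSet_Icc)
        exact measurable_measure_prodMk_right hm
  have h5 : ENNReal.ofReal 4 + ENNReal.ofReal (2 * (1 - cos tau)) * W ≤ ENNReal.ofReal (2 * (2 + 10 ^ (-12 : ℤ))) :=
    (add_le_add_left h4 _).trans (hS.trans (ENNReal.ofReal_le_ofReal (by linarith)))
  have hw : (1:ℝ)/250001 ≤ 2 * (1 - cos tau) := by linarith [cos_tau_le]
  have h6 : ENNReal.ofReal 4 + ENNReal.ofReal (1/250001) * W ≤ ENNReal.ofReal (2 * (2 + 10 ^ (-12 : ℤ))) := by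
    refine le_trans ?_ h5
    gcongr
  have hWt : W ≠ ⊤ := by
    rintro h
    rw [h, ENNReal.mul_top (by simp), add_top] at h6
    exact absurd (top_le_iff.1 h6) ENNReal.ofReal_ne_top
  rw [← ENNReal.ofReal_toReal hWt] at h6 ⊢
  rw [← ENNReal.ofReal_mul (by norm_num), ← ENNReal.ofReal_add (by norm_num) (by positivity), ENNReal.ofReal_le_ofReal_iff (by positivity)] at h6
  apply ENNReal.ofReal_le_ofReal
  norm_num at h6 ⊢
  linarith
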